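/- Define f₁(x, u) = ½uᵀRu + ½(A₁x + B₁u)ᵀP₁(A₁x + B₁u) and f₂(x, u) = ½uᵀRu + ½(A₂x + B₂u)ᵀP₂(A₂x + B₂u), where R ∈ ℝ^{d×d} and P₁, P₂ ∈ ℝ^{n×n} are positive definite, A₁, A₂ ∈ ℝ^{n×n}, B₁, B₂ ∈ ℝ^{n×d}. Let K₁ ∈ ℝ^{d×n} be the matrix such that K₁x = argmin_u f₁(x, u) for every x (i.e., K₁ = −(B₁ᵀP₁B₁ + R)⁻¹B₁ᵀP₁A₁) and define K₂ analogously from f₂. Set Γ = 1 + max{‖A₁‖, ‖B₁‖, ‖P₁‖, ‖K₁‖}. Suppose there exist ε_A, ε_B, ε_P with 0 < ε_A, ε_B, ε_P < Γ such that ‖A₁ − A₂‖ ≤ ε_A, ‖B₁ − B₂‖ ≤ ε_B, and ‖P₁ − P₂‖ ≤ ε_P. Then ‖K₁ − K₂‖ ≤ (Γ²ε_A + (3Γ³ + 2Γ²)ε_B + 4(Γ³ + Γ²)ε_P)/σ̲(R). -/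

import Mathlib

open Matrix

/-- The operator norm of a real matrix induced by the Euclidean vector norm. -/
noncomputable def mnorm {m n : ℕ} (A : Matrix (Fin m) (Fin n) ℝ) : ℝ :=
  ‖LinearMap.toContinuousLinearMap (Matrix.toEuclideanLin A)‖

/-- The Euclidean norm of a real vector. -/
noncomputable def vnorm {n : ℕ} (x : Fin n → ℝ) : ℝ :=
  Real.sqrt (∑ i, x i ^ 2)

open scoped Matrix.Norms.L2Operator in
lemma mnorm_eq {m n : ℕ} (A : Matrix (Fin m) (Fin n) ℝ) : mnorm A = ‖A‖ := rfl

lemma vnorm_eq {n : ℕ} (x : Fin n → ℝ) : vnorm x = ‖WithLp.toLp 2 x‖ := by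
  simp [vnorm, EuclideanSpace.norm_eq]

lemma vnorm_nonneg {n : ℕ} (x : Fin n → ℝ) : 0 ≤ vnorm x := Real.sqrt_nonneg _

lemma vnorm_sq {n : ℕ} (x : Fin n → ℝ) : vnorm x ^ 2 = x ⬝ᵥ x := by
  rw [vnorm, Real.sq_sqrt (Finset.sum_nonneg fun i _ => sq_nonneg _)]
  simp [dotProduct, sq]

lemma dot_le {n : ℕ} (x y : Fin n → ℝ) : x ⬝ᵥ y ≤ vnorm x * vnorm y := by
  rw [vnorm_eq, vnorm_eq]
  have := real_inner_le_norm (WithLp.toLp 2 x) (WithLp.toLp 2 y)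
  simpa [EuclideanSpace.inner_eq_star_dotProduct, dotProduct_comm] using this

lemma mnorm_mulVec {m n : ℕ} (A : Matrix (Fin m) (Fin n) ℝ) (x : Fin n → ℝ) :
    vnorm (A *ᵥ x) ≤ mnorm A * vnorm x := by
  rw [vnorm_eq, vnorm_eq]
  exact (LinearMap.toContinuousLinearMap (Matrix.toEuclideanLin A)).le_opNorm (WithLp.toLp 2 x)

lemma mnorm_le {m n : ℕ} (A : Matrix (Fin m) (Fin n) ℝ) (c : ℝ) (hc : 0 ≤ c)
    (h : ∀ x, vnorm (A *ᵥ x) ≤ c * vnorm x) : mnorm A ≤ c := by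
  refine ContinuousLinearMap.opNorm_le_bound _ hc fun x => ?_
  have := h x.ofLp
  rw [vnorm_eq, vnorm_eq] at this
  exact this

lemma mnorm_nonneg {m n : ℕ} (A : Matrix (Fin m) (Fin n) ℝ) : 0 ≤ mnorm A := norm_nonneg _

open scoped Matrix.Norms.L2Operator in
lemma mnorm_add {m n : ℕ} (A B : Matrix (Fin m) (Fin n) ℝ) :
    mnorm (A + B) ≤ mnorm A + mnorm B := norm_add_le A B

open scoped Matrix.Norms.L2Operator in
lemma mnorm_sub_comm {m n : ℕ} (A B : Matrix (Fin m) (Fin n) ℝ) :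
    mnorm (A - B) = mnorm (B - A) := norm_sub_rev A B

open scoped Matrix.Norms.L2Operator in
lemma mnorm_tr {m n : ℕ} (A : Matrix (Fin m) (Fin n) ℝ) : mnorm Aᵀ = mnorm A := by
  have := Matrix.l2_opNorm_conjTranspose A
  rwa [conjTranspose_eq_transpose_of_trivial] at this

open scoped Matrix.Norms.L2Operator in
lemma mnorm_mul {m n k : ℕ} (A : Matrix (Fin m) (Fin n) ℝ) (B : Matrix (Fin n) (Fin k) ℝ) :
    mnorm (A * B) ≤ mnorm A * mnorm B := Matrix.l2_opNorm_mul A B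

lemma mnorm_mul_le {m n k : ℕ} {A : Matrix (Fin m) (Fin n) ℝ} {B : Matrix (Fin n) (Fin k) ℝ}
    {a b : ℝ} (hA : mnorm A ≤ a) (hB : mnorm B ≤ b) :
    mnorm (A * B) ≤ a * b :=
  (mnorm_mul A B).trans (mul_le_mul hA hB (mnorm_nonneg _) ((mnorm_nonneg _).trans hA))

lemma lower_quad {d : ℕ} (R : Matrix (Fin d) (Fin d) ℝ) (hR : R.PosDef) (σ : ℝ)
    (hσR : ∀ v : Fin d → ℝ, σ * vnorm v ≤ vnorm (R.mulVec v)) (y : Fin d → ℝ) :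
    σ * vnorm y ^ 2 ≤ y ⬝ᵥ R *ᵥ y := by
  have hH : (R - σ • (1 : Matrix (Fin d) (Fin d) ℝ)).IsHermitian :=
    hR.1.sub (by simp [Matrix.IsHermitian])
  have hps : (R - σ • (1 : Matrix (Fin d) (Fin d) ℝ)).PosSemidef := by
    rw [hH.posSemidef_iff_eigenvalues_nonneg]
    intro i
    have h1 := hH.mulVec_eigenvectorBasis i
    set w : Fin d → ℝ := (hH.eigenvectorBasis i).ofLp with hw
    set μ := hH.eigenvalues i
    have hn : vnorm w = 1 := by
      rw [vnorm_eq]; exact hH.eigenvectorBasis.orthonormal.1 i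
    have h2 : R *ᵥ w = (μ + σ) • w := by
      rw [sub_mulVec, smul_mulVec, one_mulVec] at h1
      rw [add_smul, ← h1]; simp
    have hw0 : w ≠ 0 := by
      intro h; rw [h] at hn; simp [vnorm] at hn
    have h3 := hR.dotProduct_mulVec_pos hw0
    have h4 := vnorm_sq w
    rw [h2] at h3
    simp only [star_trivial, dotProduct_smul, ← h4, hn, smul_eq_mul] at h3
    have h5 := hσR w
    rw [h2, hn, vnorm_eq, WithLp.toLp_smul, norm_smul, ← vnorm_eq, hn, Real.norm_eq_abs,
      abs_of_pos (by linarith)] at h5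
    show 0 ≤ μ
    linarith
  have := hps.dotProduct_mulVec_nonneg y
  rw [sub_mulVec, smul_mulVec, one_mulVec] at this
  simp only [star_trivial, dotProduct_sub, dotProduct_smul, smul_eq_mul] at this
  rw [vnorm_sq]; linarith

/-- Lemma 8 of the paper, perturbation of LQR one-step minimizers.
With `K₁ = -(B₁ᵀP₁B₁ + R)⁻¹B₁ᵀP₁A₁`, `K₂ = -(B₂ᵀP₂B₂ + R)⁻¹B₂ᵀP₂A₂`,
`Γ = 1 + max{‖A₁‖, ‖B₁‖, ‖P₁‖, ‖K₁‖}`, and perturbations `ε_A, ε_B, ε_P < Γ`, we get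
`‖K₁ - K₂‖ ≤ (Γ²ε_A + (3Γ³ + 2Γ²)ε_B + 4(Γ³ + Γ²)ε_P)/σ̲(R)`, where `σ̲(R)` is the
smallest singular value of `R` (formalized via an arbitrary lower bound `σ` on `‖Rv‖/‖v‖`). -/
theorem statement8
    (n d : ℕ)
    (A₁ A₂ : Matrix (Fin n) (Fin n) ℝ) (B₁ B₂ : Matrix (Fin n) (Fin d) ℝ)
    (R : Matrix (Fin d) (Fin d) ℝ) (P₁ P₂ : Matrix (Fin n) (Fin n) ℝ)
    (hR : R.PosDef) (hP₁ : P₁.PosDef) (hP₂ : P₂.PosDef)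
    (K₁ K₂ : Matrix (Fin d) (Fin n) ℝ)
    (hK₁ : K₁ = -((B₁ᵀ * P₁ * B₁ + R)⁻¹ * (B₁ᵀ * P₁ * A₁)))
    (hK₂ : K₂ = -((B₂ᵀ * P₂ * B₂ + R)⁻¹ * (B₂ᵀ * P₂ * A₂)))
    (Γ : ℝ)
    (hΓ : Γ = 1 + max (max (mnorm A₁) (mnorm B₁)) (max (mnorm P₁) (mnorm K₁)))
    (εA εB εP : ℝ)
    (hεA0 : 0 < εA) (hεB0 : 0 < εB) (hεP0 : 0 < εP)
    (hεAΓ : εA < Γ) (hεBΓ : εB < Γ) (hεPΓ : εP < Γ)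
    (hA : mnorm (A₁ - A₂) ≤ εA) (hB : mnorm (B₁ - B₂) ≤ εB)
    (hP : mnorm (P₁ - P₂) ≤ εP)
    -- `σ` is a positive lower bound on the singular values of `R`
    (σ : ℝ) (hσ : 0 < σ)
    (hσR : ∀ v : Fin d → ℝ, σ * vnorm v ≤ vnorm (R.mulVec v)) :
    mnorm (K₁ - K₂) ≤
      (Γ ^ 2 * εA + (3 * Γ ^ 3 + 2 * Γ ^ 2) * εB + 4 * (Γ ^ 3 + Γ ^ 2) * εP) / σ := by

  have hS : ∀ (B : Matrix (Fin n) (Fin d) ℝ) (P : Matrix (Fin n) (Fin n) ℝ), P.PosDef →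
      (Bᵀ * P * B).PosSemidef := by
    intro B P hP
    have := hP.posSemidef.conjTranspose_mul_mul_same B
    rwa [conjTranspose_eq_transpose_of_trivial] at this
  have hSK : ∀ (A : Matrix (Fin n) (Fin n) ℝ) (B : Matrix (Fin n) (Fin d) ℝ)
      (P : Matrix (Fin n) (Fin n) ℝ) (K : Matrix (Fin d) (Fin n) ℝ), P.PosDef →
      K = -((Bᵀ * P * B + R)⁻¹ * (Bᵀ * P * A)) →
      (Bᵀ * P * B + R) * K = -(Bᵀ * P * A) := by
    intro A B P K hP hK
    have hu : IsUnit (Bᵀ * P * B + R).det :=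
      (Matrix.isUnit_iff_isUnit_det _).1 (Matrix.PosDef.posSemidef_add (hS B P hP) hR).isUnit
    rw [hK, Matrix.mul_neg, Matrix.mul_nonsing_inv_cancel_left _ _ hu]
  have e1 := hSK A₁ B₁ P₁ K₁ hP₁ hK₁
  have e2 := hSK A₂ B₂ P₂ K₂ hP₂ hK₂
  have gA : mnorm A₁ ≤ Γ := by
    have := (le_max_left (mnorm A₁) (mnorm B₁)).trans (le_max_left _ (max (mnorm P₁) (mnorm K₁)))
    linarith
  have gB : mnorm B₁ ≤ Γ := by
    have := (le_max_right (mnorm A₁) (mnorm B₁)).trans (le_max_left _ (max (mnorm P₁) (mnorm K₁)))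
    linarith
  have gP : mnorm P₁ ≤ Γ := by
    have := (le_max_left (mnorm P₁) (mnorm K₁)).trans (le_max_right (max (mnorm A₁) (mnorm B₁)) _)
    linarith
  have gK : mnorm K₁ ≤ Γ := by
    have := (le_max_right (mnorm P₁) (mnorm K₁)).trans (le_max_right (max (mnorm A₁) (mnorm B₁)) _)
    linarith
  rw [mnorm_sub_comm] at hA hB hP
  have gA2 : mnorm A₂ ≤ 2 * Γ := by
    have := mnorm_add A₁ (A₂ - A₁)
    rw [add_sub_cancel] at this
    linarith
  have gB2 : mnorm B₂ ≤ 2 * Γ := by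
    have := mnorm_add B₁ (B₂ - B₁)
    rw [add_sub_cancel] at this
    linarith
  have gBt : mnorm B₁ᵀ ≤ Γ := by rwa [mnorm_tr]
  have gBt2 : mnorm B₂ᵀ ≤ 2 * Γ := by rwa [mnorm_tr]
  have hBt : mnorm (B₂ - B₁)ᵀ ≤ εB := by rwa [mnorm_tr]
  have hΓ0 : 0 < Γ := by linarith
  set M := Γ ^ 2 * εA + (3 * Γ ^ 3 + 2 * Γ ^ 2) * εB + 4 * (Γ ^ 3 + Γ ^ 2) * εP with hM
  have hM0 : 0 ≤ M := by positivity
  have key : (B₂ᵀ * P₂ * B₂ + R) * (K₁ - K₂) =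
      (B₁ᵀ * P₁ * (B₂ - B₁) + (B₂ - B₁)ᵀ * P₁ * B₂ + B₂ᵀ * (P₂ - P₁) * B₂) * K₁
      + (B₁ᵀ * P₁ * (A₂ - A₁) + (B₂ - B₁)ᵀ * P₁ * A₂ + B₂ᵀ * (P₂ - P₁) * A₂) := by
    have e3 : R * K₁ = -(B₁ᵀ * P₁ * A₁) - B₁ᵀ * P₁ * B₁ * K₁ := by
      rw [← e1, Matrix.add_mul, add_sub_cancel_left]
    rw [Matrix.mul_sub, e2, Matrix.add_mul, e3, transpose_sub]
    simp only [Matrix.mul_sub, Matrix.sub_mul, Matrix.add_mul]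
    abel
  have hD : mnorm ((B₂ᵀ * P₂ * B₂ + R) * (K₁ - K₂)) ≤ M := by
    rw [key]
    have t1 := mnorm_mul_le (mnorm_mul_le gBt gP) hB
    have t2 := mnorm_mul_le (mnorm_mul_le hBt gP) gB2
    have t3 := mnorm_mul_le (mnorm_mul_le gBt2 hP) gB2
    have t4 := mnorm_mul_le (mnorm_mul_le gBt gP) hA
    have t5 := mnorm_mul_le (mnorm_mul_le hBt gP) gA2
    have t6 := mnorm_mul_le (mnorm_mul_le gBt2 hP) gA2
    have u1 := mnorm_mul_le (((mnorm_add _ _).trans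
      (add_le_add ((mnorm_add _ _).trans (add_le_add t1 t2)) t3))) gK
    have u2 := ((mnorm_add _ _).trans
      (add_le_add ((mnorm_add _ _).trans (add_le_add t4 t5)) t6))
    refine (mnorm_add _ _).trans ((add_le_add u1 u2).trans (le_of_eq ?_))
    rw [hM]; ring
  refine mnorm_le _ _ (by positivity) fun x => ?_
  set y := (K₁ - K₂) *ᵥ x with hy
  have q1 := lower_quad R hR σ hσR y
  have q2 := (hS B₂ P₂ hP₂).dotProduct_mulVec_nonneg y
  rw [star_trivial] at q2
  have q3 := dot_le y ((B₂ᵀ * P₂ * B₂ + R) *ᵥ y)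
  have q4 : vnorm ((B₂ᵀ * P₂ * B₂ + R) *ᵥ y) ≤ M * vnorm x := by
    rw [hy, mulVec_mulVec]
    exact (mnorm_mulVec _ _).trans (mul_le_mul_of_nonneg_right hD (vnorm_nonneg _))
  rw [add_mulVec, dotProduct_add, ← add_mulVec] at q3
  rw [div_mul_eq_mul_div, le_div_iff₀ hσ]
  rcases (vnorm_nonneg y).eq_or_lt with h0 | h0
  · rw [← h0, zero_mul]; exact mul_nonneg hM0 (vnorm_nonneg _)
  · refine le_trans (le_of_mul_le_mul_left ?_ h0) q4
    nlinarith
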